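/- Let n ≥ 1 and l ≥ 0 be integers. A vector c ∈ (ℝⁿ)^{⊗l} satisfies g^{⊗l} c = c for all g ∈ O(n) if and only if c lies in the linear span of the vectors v_β = Σ_{I ∈ [n]^l} (∏_{{p,q}∈β} δ_{i_p,i_q}) e_{i₁} ⊗ … ⊗ e_{i_l}, where β ranges over all partitions of {1,…,l} into disjoint pairs and e₁,…,e_n is the standard basis of ℝⁿ. In particular, if l is odd then c = 0 is the only such vector. -/

import Mathlib

open Matrix

noncomputable section

/-- The matrix of `g^{⊗l}` in the standard basis of `(ℝⁿ)^{⊗l}`. -/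
def tpowM {n : ℕ} (l : ℕ) (g : Matrix (Fin n) (Fin n) ℝ) :
    Matrix (Fin l → Fin n) (Fin l → Fin n) ℝ :=
  Matrix.of fun I J => ∏ r, g (I r) (J r)

/-- A partition of `{1, …, l}` into disjoint pairs (a perfect matching),
encoded as a fixed-point-free involution: the blocks are the sets `{p, pair p}`. -/
structure BrauerPairing (N : ℕ) where
  pair : Fin N → Fin N
  invol : ∀ p, pair (pair p) = p
  ne : ∀ p, pair p ≠ p

namespace FFT
variable {ι : Type} [Fintype ι] [DecidableEq ι] {n : ℕ}

/-- Invariance of a tensor with arbitrary finite index set. -/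
def Inv (w : (ι → Fin n) → ℝ) : Prop :=
  ∀ g : Matrix (Fin n) (Fin n) ℝ, gᵀ * g = 1 →
    ∀ I, ∑ J : ι → Fin n, (∏ r, g (I r) (J r)) * w J = w I

/-- derivation action of an elementary matrix -/
def F (a b : Fin n) (w : (ι → Fin n) → ℝ) (I : ι → Fin n) : ℝ :=
  ∑ r, if I r = a then w (Function.update I r b) else 0

lemma sum_erase (I : ι → Fin n) (r : ι) (f : (ι → Fin n) → ℝ) :
    ∑ J : ι → Fin n, (∏ s ∈ Finset.univ.erase r, (1 : Matrix (Fin n) (Fin n) ℝ) (I s) (J s)) * f J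
      = ∑ j, f (Function.update I r j) := by
  symm
  apply Finset.sum_of_injOn (fun j => Function.update I r j)
  · intro x _ y _ h
    exact Function.update_injective I r h
  · intro x _; simp
  · intro J _ hJ
    have : ∃ s, s ≠ r ∧ I s ≠ J s := by
      by_contra hcon
      push Not at hcon
      apply hJ
      refine ⟨J r, by simp, ?_⟩
      funext s
      by_cases hs : s = r
      · subst hs; simp
      · simp [hs, hcon s hs]
    obtain ⟨s, hs, hne⟩ := this
    rw [Finset.prod_eq_zero (i := s) (by simp [hs]) (by simp [hne])]
    simp
  · intro j _
    rw [Finset.prod_eq_one]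
    · simp
    · intro s hs
      have : s ≠ r := (Finset.mem_erase.1 hs).1
      rw [Function.update_of_ne this, Matrix.one_apply_eq]

lemma F_symm {w : (ι → Fin n) → ℝ} (hw : Inv w) (a b : Fin n) : F a b w = F b a w := by
  by_cases hab : a = b
  · rw [hab]
  funext I
  set X : Matrix (Fin n) (Fin n) ℝ := Matrix.single a b 1 - Matrix.single b a 1 with hX
  have hXT : Xᵀ = -X := by
    simp [hX, Matrix.transpose_sub]
  have hX3 : X * X * X = -X := by
    simp [hX, sub_mul, mul_sub, hab, Ne.symm hab]
    abel
  let g : ℝ → Matrix (Fin n) (Fin n) ℝ := fun t =>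
    1 + Real.sin t • X + (1 - Real.cos t) • (X * X)
  have hg : ∀ t, (g t)ᵀ * g t = 1 := by
    intro t
    have h1 : (g t)ᵀ = 1 - Real.sin t • X + (1 - Real.cos t) • (X * X) := by
      simp only [g, Matrix.transpose_add, Matrix.transpose_smul, Matrix.transpose_mul, hXT,
        Matrix.transpose_one]
      simp [sub_eq_add_neg]
    have h4 : X * X * (X * X) = -(X * X) := by
      rw [← mul_assoc, hX3]; simp
    have h3 : X * (X * X) = -X := by rw [← mul_assoc, hX3]
    have hsc := Real.sin_sq_add_cos_sq t
    rw [h1]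
    simp only [g, add_mul, sub_mul, mul_add, mul_one, one_mul, smul_mul_assoc, mul_smul_comm,
      h4, h3, hX3]
    have : Real.sin t * Real.sin t = 1 - Real.cos t * Real.cos t := by nlinarith
    have e : ((1 : ℝ) - Real.cos t) * (1 - Real.cos t) + Real.sin t * Real.sin t
        - 2 * (1 - Real.cos t) = 0 := by linarith
    rw [← sub_eq_zero]
    calc _ = -((((1 : ℝ) - Real.cos t) * (1 - Real.cos t) + Real.sin t * Real.sin t
        - 2 * (1 - Real.cos t)) • (X * X)) := by module
      _ = 0 := by rw [e]; simp
  have hd : ∀ i j, HasDerivAt (fun t => g t i j) (X i j) 0 := by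
    intro i j
    have h1 : HasDerivAt (fun t => (1 : Matrix (Fin n) (Fin n) ℝ) i j + Real.sin t * X i j
      + (1 - Real.cos t) * (X * X) i j) (0 + Real.cos 0 * X i j + (0 - -Real.sin 0) * (X * X) i j) 0 :=
      (((hasDerivAt_const _ _).add ((Real.hasDerivAt_sin 0).mul_const _))).add
        (((hasDerivAt_const _ _).sub (Real.hasDerivAt_cos 0)).mul_const _)
    simpa [g] using h1
  have h0 : g 0 = 1 := by simp [g]
  have hD : HasDerivAt (fun t => ∑ J : ι → Fin n, (∏ r, g t (I r) (J r)) * w J)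
      (∑ J : ι → Fin n, (∑ r, (∏ s ∈ Finset.univ.erase r, g 0 (I s) (J s)) • X (I r) (J r)) * w J) 0 := by
    apply HasDerivAt.fun_sum
    intro J _
    exact (HasDerivAt.fun_finsetProd (fun r _ => hd (I r) (J r))).mul_const _
  have hC : HasDerivAt (fun t => ∑ J : ι → Fin n, (∏ r, g t (I r) (J r)) * w J) 0 0 := by
    have : (fun t => ∑ J : ι → Fin n, (∏ r, g t (I r) (J r)) * w J) = fun _ => w I := by
      funext t; exact hw _ (hg t) I
    rw [this]; exact hasDerivAt_const _ _
  have hE := hD.unique hC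
  rw [h0] at hE
  simp only [Finset.sum_mul, smul_eq_mul, mul_assoc] at hE
  rw [Finset.sum_comm] at hE
  rw [← sub_eq_zero, ← hE]
  unfold F
  rw [← Finset.sum_sub_distrib]
  refine Finset.sum_congr rfl fun r _ => ?_
  rw [sum_erase I r (fun J => X (I r) (J r) * w J)]
  simp only [hX, Matrix.sub_apply, Matrix.single_apply, Function.update_self, sub_mul,
    Finset.sum_sub_distrib, ite_and, ite_mul, one_mul, zero_mul]
  congr 1 <;> simp only [eq_comm (a := I r)] <;> split_ifs <;> simp

lemma F_adj (a b : Fin n) (w u : (ι → Fin n) → ℝ) :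
    ∑ I, F a b w I * u I = ∑ I, w I * F b a u I := by
  simp only [F, Finset.sum_mul, Finset.mul_sum]
  rw [Finset.sum_comm, Finset.sum_comm (s := Finset.univ (α := ι → Fin n))]
  refine Finset.sum_congr rfl fun r _ => ?_
  simp only [ite_mul, mul_ite, zero_mul, mul_zero]
  rw [← Finset.sum_filter, ← Finset.sum_filter]
  refine Finset.sum_bij' (fun I _ => Function.update I r b) (fun I _ => Function.update I r a)
    ?_ ?_ ?_ ?_ ?_
  · simp
  · simp
  · intro I hI; simp at hI; simp [← hI]
  · intro I hI; simp at hI; simp [← hI]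
  · intro I hI; simp at hI; simp [← hI]

lemma F_sq {w : (ι → Fin n) → ℝ}
    (ht : ∀ r s, r ≠ s → ∀ I : ι → Fin n,
      ∑ a, w (Function.update (Function.update I r a) s a) = 0) (I : ι → Fin n) :
    ∑ a, ∑ b, F b a (F b a w) I = Fintype.card ι * w I := by
  have h1 : ∀ r s, (∑ a, ∑ b, if I r = b then
      (if Function.update I r a s = b then
        w (Function.update (Function.update I r a) s a) else 0) else 0)
      = if r = s then w I else 0 := by
    intro r s
    simp only [Finset.sum_ite_eq, Finset.mem_univ, if_true]
    by_cases h : r = s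
    · subst h; simp
    · by_cases h2 : I s = I r
      · simpa [h, Ne.symm h, h2] using ht r s h I
      · simp [h, Ne.symm h, h2]
  have h2 : ∑ a, ∑ b, F b a (F b a w) I = ∑ r, ∑ s, (∑ a, ∑ b, if I r = b then
      (if Function.update I r a s = b then
        w (Function.update (Function.update I r a) s a) else 0) else 0) := by
    have : ∀ a b, F b a (F b a w) I = ∑ r, ∑ s, if I r = b then
      (if Function.update I r a s = b then
        w (Function.update (Function.update I r a) s a) else 0) else 0 := by
      intro a b
      unfold F
      refine Finset.sum_congr rfl fun r _ => ?_
      split_ifs <;> simp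
    simp only [this]
    have e1 : ∀ a, (∑ b, ∑ r, ∑ s, if I r = b then
      (if Function.update I r a s = b then
        w (Function.update (Function.update I r a) s a) else 0) else 0)
        = ∑ r, ∑ s, ∑ b, if I r = b then
      (if Function.update I r a s = b then
        w (Function.update (Function.update I r a) s a) else 0) else 0 := by
      intro a
      rw [Finset.sum_comm]
      refine Finset.sum_congr rfl fun r _ => ?_
      rw [Finset.sum_comm]
    simp only [e1]
    rw [Finset.sum_comm]
    refine Finset.sum_congr rfl fun r _ => ?_
    rw [Finset.sum_comm]
  rw [h2]
  simp only [h1]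
  simp

lemma inv_diag {w : (ι → Fin n) → ℝ} (hw : Inv w) (d : Fin n → ℝ) (hd : ∀ i, d i * d i = 1)
    (I : ι → Fin n) : (∏ r, d (I r)) * w I = w I := by
  have h := hw (Matrix.diagonal d) (by simp [Matrix.diagonal_mul_diagonal, hd]) I
  rw [Finset.sum_eq_single I] at h
  · simpa using h
  · intro J _ hJ
    obtain ⟨r, hr⟩ := Function.ne_iff.1 hJ
    rw [Finset.prod_eq_zero (i := r) (by simp) (by simp [hr.symm])]
    simp
  · simp

lemma key {w : (ι → Fin n) → ℝ} (hw : Inv w) (hι : 0 < Fintype.card ι)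
    (ht : ∀ r s, r ≠ s → ∀ I : ι → Fin n,
      ∑ a, w (Function.update (Function.update I r a) s a) = 0) : w = 0 := by
  have h1 : ∑ a, ∑ b, ∑ I, F b a w I * F b a w I = Fintype.card ι * ∑ I, w I * w I := by
    have e : ∀ a b, ∑ I, F b a w I * F b a w I = ∑ I, w I * F b a (F b a w) I := by
      intro a b
      have e' : ∑ I, F b a w I * F b a w I = ∑ I, F a b w I * F b a w I := by
        rw [F_symm hw b a]
      rw [e', F_adj]
    simp only [e]
    rw [Finset.mul_sum]
    have : ∀ I, (Fintype.card ι : ℝ) * (w I * w I) = ∑ a, ∑ b, w I * F b a (F b a w) I := by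
      intro I
      simp only [← Finset.mul_sum]
      rw [F_sq ht]; ring
    simp only [this]
    symm
    rw [Finset.sum_comm]
    refine Finset.sum_congr rfl fun a _ => ?_
    rw [Finset.sum_comm]
  have h2 : ∑ a, ∑ I, F a a w I * F a a w I ≤ ∑ a, ∑ b, ∑ I, F b a w I * F b a w I := by
    refine Finset.sum_le_sum fun a _ => ?_
    exact Finset.single_le_sum (f := fun b => ∑ I, F b a w I * F b a w I)
      (fun b _ => Finset.sum_nonneg fun I _ => mul_self_nonneg _) (Finset.mem_univ a)
  have h3 : ∀ I, 2 * Fintype.card ι * (w I * w I) ≤ ∑ a, F a a w I * F a a w I := by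
    intro I
    by_cases hI : w I = 0
    · rw [hI]; simp; exact Finset.sum_nonneg fun I _ => mul_self_nonneg _
    have hF : ∀ a, F a a w I = ((Finset.univ.filter (fun r => I r = a)).card : ℝ) * w I := by
      intro a
      unfold F
      rw [← Finset.sum_filter, Finset.sum_congr rfl (g := fun _ => w I)]
      · simp
      · intro r hr
        simp at hr
        simp [← hr]
    have hev : ∀ a, Even (Finset.univ.filter (fun r => I r = a)).card := by
      intro a
      have := inv_diag hw (fun i => if i = a then -1 else 1) (by intro i; split_ifs <;> simp) I
      have h := mul_right_cancel₀ hI (this.trans (one_mul _).symm)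
      rw [Finset.prod_ite] at h
      simp at h
      by_contra hodd
      rw [Nat.not_even_iff_odd] at hodd
      rw [hodd.neg_one_pow] at h
      norm_num at h
    have hsum : ∑ a, (Finset.univ.filter (fun r => I r = a)).card = Fintype.card ι :=
      (Finset.card_eq_sum_card_fiberwise (f := I) (s := Finset.univ) (t := Finset.univ)
        (by simp [Set.MapsTo])).symm
    rw [← hsum]
    push_cast
    rw [Finset.mul_sum, Finset.sum_mul]
    refine Finset.sum_le_sum fun a _ => ?_
    rw [hF a]
    obtain ⟨k, hk⟩ := hev a
    rw [hk]
    have : (k : ℝ) ≤ k * k := by exact_mod_cast Nat.le_mul_self k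
    have := mul_le_mul_of_nonneg_right this (mul_self_nonneg (w I))
    push_cast
    nlinarith
  have h4 : 2 * Fintype.card ι * ∑ I, (w I * w I) ≤ ∑ a, ∑ I, F a a w I * F a a w I := by
    rw [Finset.sum_comm, Finset.mul_sum]
    exact Finset.sum_le_sum fun I _ => h3 I
  have h5 : (0 : ℝ) < Fintype.card ι := by exact_mod_cast hι
  have h6 : ∑ I, (w I * w I) = 0 := by
    have : 0 ≤ ∑ I, (w I * w I) := Finset.sum_nonneg fun I _ => mul_self_nonneg _
    nlinarith
  funext I
  have := (Finset.sum_eq_zero_iff_of_nonneg (fun I _ => mul_self_nonneg (w I))).1 h6 I (by simp)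
  simpa using this


lemma inv_reindex {κ : Type} [Fintype κ] [DecidableEq κ] (e : κ ≃ ι) {w : (ι → Fin n) → ℝ}
    (hw : Inv w) : Inv (fun J : κ → Fin n => w (J ∘ e.symm)) := by
  intro g hg I
  refine Eq.trans ?_ (hw g hg (I ∘ e.symm))
  refine Fintype.sum_equiv (Equiv.arrowCongr e (Equiv.refl _)) _ _ ?_
  intro J
  congr 1
  exact Fintype.prod_equiv e _ _ (by simp)

/-- extension of an index by two letters -/
def ext2 {κ : Type} (I : κ → Fin n) (a b : Fin n) : Option (Option κ) → Fin n
  | none => a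
  | some none => b
  | some (some x) => I x

lemma sum_ext2 {κ : Type} [Fintype κ] [DecidableEq κ] (f : (Option (Option κ) → Fin n) → ℝ) :
    ∑ J, f J = ∑ a, ∑ b, ∑ I : κ → Fin n, f (ext2 I a b) := by
  have : ∑ J, f J = ∑ p : Fin n × Fin n × (κ → Fin n), f (ext2 p.2.2 p.1 p.2.1) := by
    refine (Fintype.sum_bijective (fun p : Fin n × Fin n × (κ → Fin n) => ext2 p.2.2 p.1 p.2.1)
      ⟨?_, ?_⟩ _ _ (fun _ => rfl)).symm
    · rintro ⟨a, b, I⟩ ⟨a', b', I'⟩ h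
      have h1 := congrFun h none
      have h2 := congrFun h (some none)
      have h3 : I = I' := funext fun x => congrFun h (some (some x))
      simp only [ext2] at h1 h2
      simp [h1, h2, h3]
    · intro J
      refine ⟨⟨J none, J (some none), fun x => J (some (some x))⟩, ?_⟩
      funext x
      rcases x with _ | _ | x <;> rfl
  rw [this]
  simp only [Fintype.sum_prod_type]

lemma inv_trace {κ : Type} [Fintype κ] [DecidableEq κ] {w : (Option (Option κ) → Fin n) → ℝ}
    (hw : Inv w) : Inv (fun I : κ → Fin n => ∑ a, w (ext2 I a a)) := by
  intro g hg I
  have h : ∀ a, w (ext2 I a a) = ∑ b, ∑ c, ∑ J : κ → Fin n,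
      (g a b * g a c) * ((∏ r, g (I r) (J r)) * w (ext2 J b c)) := by
    intro a
    rw [← hw g hg (ext2 I a a), sum_ext2]
    refine Finset.sum_congr rfl fun b _ => Finset.sum_congr rfl fun c _ =>
      Finset.sum_congr rfl fun J _ => ?_
    rw [Fintype.prod_option, Fintype.prod_option]
    simp only [ext2]
    ring
  have ho : ∀ b c, ∑ a, g a b * g a c = if b = c then 1 else 0 := by
    intro b c
    have := congrFun (congrFun hg b) c
    simpa [Matrix.mul_apply, Matrix.one_apply] using this
  simp only [h]
  rw [Finset.sum_comm]
  have h2 : ∀ b, (∑ a, ∑ c, ∑ J : κ → Fin n,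
      (g a b * g a c) * ((∏ r, g (I r) (J r)) * w (ext2 J b c)))
      = ∑ J : κ → Fin n, (∏ r, g (I r) (J r)) * w (ext2 J b b) := by
    intro b
    rw [Finset.sum_comm]
    simp only [← Finset.mul_sum, ← Finset.sum_mul, ho]
    simp
  simp only [h2]
  rw [Finset.sum_comm]
  simp only [Finset.mul_sum]

/-- invariant tensors orthogonal to all pairings vanish -/
lemma main_aux (N : ℕ) : ∀ (ι : Type) [Fintype ι] [DecidableEq ι] (w : (ι → Fin n) → ℝ),
    Fintype.card ι = N → Inv w →
    (∀ β : ι → ι, (∀ p, β (β p) = p) → (∀ p, β p ≠ p) →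
      ∑ I : ι → Fin n, (if ∀ p, I p = I (β p) then w I else 0) = 0) → w = 0 := by
  induction N using Nat.strong_induction_on with
  | _ N ih =>
  intro ι _ _ w hN hw ho
  rcases Nat.eq_zero_or_pos N with h0 | hpos
  · have hE : IsEmpty ι := Fintype.card_eq_zero_iff.1 (hN.trans h0)
    have := ho id (by simp) (fun p => hE.elim p)
    funext I
    simpa [Subsingleton.elim I default] using this
  apply key hw (by omega)
  intro r s hrs I
  let κ := {x : ι // x ≠ r ∧ x ≠ s}
  let f : Option (Option κ) → ι
    | none => r
    | some none => s
    | some (some x) => x.1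
  have hf : Function.Bijective f := by
    constructor
    · rintro (_ | _ | x) (_ | _ | y) h
      · rfl
      · exact absurd h hrs
      · exact absurd h.symm y.2.1
      · exact absurd h hrs.symm
      · rfl
      · exact absurd h.symm y.2.2
      · exact absurd h x.2.1
      · exact absurd h x.2.2
      · rw [Subtype.ext h]
    · intro x
      by_cases h1 : x = r
      · exact ⟨none, h1.symm⟩
      by_cases h2 : x = s
      · exact ⟨some none, h2.symm⟩
      exact ⟨some (some ⟨x, h1, h2⟩), rfl⟩
  let e : Option (Option κ) ≃ ι := Equiv.ofBijective f hf
  have hi := inv_trace (inv_reindex e hw)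
  have hcard : Fintype.card κ < N := by
    have := Fintype.card_congr e
    simp only [Fintype.card_option] at this
    omega
  have hz := ih _ hcard κ _ rfl hi ?_
  · have := congrFun hz (fun x => I x.1)
    simp only [Pi.zero_apply] at this
    rw [← this]
    refine Finset.sum_congr rfl fun a _ => ?_
    congr 1
    funext x
    obtain ⟨y, rfl⟩ := e.surjective x
    simp only [Function.comp, Equiv.symm_apply_apply]
    rcases y with _ | _ | y
    · change Function.update (Function.update I r a) s a r = a
      simp [hrs]
    · change Function.update (Function.update I r a) s a s = a
      simp
    · change Function.update (Function.update I r a) s a y.1 = I y.1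
      simp [y.2.1, y.2.2]
  · intro β hβ hne
    let β' : Option (Option κ) → Option (Option κ)
      | none => some none
      | some none => none
      | some (some x) => some (some (β x))
    have h := ho (fun p => e (β' (e.symm p))) ?_ ?_
    · refine Eq.trans ?_ h
      symm
      rw [← Fintype.sum_equiv (Equiv.arrowCongr e (Equiv.refl (Fin n)))
        (fun J => if ∀ p, J p = J (β' p) then w (J ∘ e.symm) else 0) _ ?_]
      · rw [sum_ext2]
        have hall : ∀ (J : κ → Fin n) a b, (∀ p, ext2 J a b p = ext2 J a b (β' p)) ↔
            (a = b ∧ ∀ p, J p = J (β p)) := by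
          intro J a b
          constructor
          · intro hp
            exact ⟨hp none, fun p => hp (some (some p))⟩
          · rintro ⟨h1, h2⟩ (_ | _ | p)
            · exact h1
            · exact h1.symm
            · exact h2 p
        simp only [hall, ite_and]
        have h3 : ∀ a b, (∑ J : κ → Fin n, if a = b then
            (if ∀ p, J p = J (β p) then w (ext2 J a b ∘ e.symm) else 0) else 0)
            = if a = b then ∑ J : κ → Fin n,
              (if ∀ p, J p = J (β p) then w (ext2 J a b ∘ e.symm) else 0) else 0 := by
          intro a b; split_ifs <;> simp
        simp only [h3, Finset.sum_ite_eq, Finset.mem_univ, if_true]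
        rw [Finset.sum_comm]
        refine Finset.sum_congr rfl fun J _ => ?_
        split_ifs
        · rfl
        · simp
      · intro J
        have : (∀ p, J p = J (β' p)) ↔
          ∀ p, (J ∘ e.symm) p = (J ∘ e.symm) (e (β' (e.symm p))) := by
          rw [← e.forall_congr_right]
          simp
        simp only [this]
        rfl
    · intro p
      obtain ⟨y, rfl⟩ := e.surjective p
      rcases y with _ | _ | y <;> simp [β', hβ]
    · intro p
      obtain ⟨y, rfl⟩ := e.surjective p
      rcases y with _ | _ | y <;> simp [β', hne]


lemma inv_iff {l : ℕ} (c : (Fin l → Fin n) → ℝ) : Inv c ↔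
    ∀ g : Matrix (Fin n) (Fin n) ℝ, gᵀ * g = 1 → (tpowM l g).mulVec c = c := by
  constructor
  · intro h g hg
    funext I
    exact h g hg I
  · intro h g hg I
    exact congrFun (h g hg) I

/-- the vector of a pairing -/
def vec (n : ℕ) {l : ℕ} (β : BrauerPairing l) : (Fin l → Fin n) → ℝ :=
  fun I => ∏ p ∈ Finset.univ.filter (fun p => p < β.pair p),
            if I p = I (β.pair p) then (1 : ℝ) else 0

lemma vec_eq {l : ℕ} (β : BrauerPairing l) (I : Fin l → Fin n) :
    vec n β I = if ∀ p, I p = I (β.pair p) then 1 else 0 := by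
  unfold vec
  split_ifs with h
  · exact Finset.prod_eq_one fun p _ => by rw [if_pos (h p)]
  · push Not at h
    obtain ⟨p, hp⟩ := h
    rcases lt_or_gt_of_ne (β.ne p) with h1 | h1
    · refine Finset.prod_eq_zero (i := β.pair p) (by simp [β.invol, h1]) ?_
      rw [β.invol, if_neg (Ne.symm hp)]
    · refine Finset.prod_eq_zero (i := p) (by simp [h1]) ?_
      rw [if_neg hp]

lemma vec_inv {l : ℕ} (β : BrauerPairing l) : Inv (vec n β) := by
  intro g hg I
  have hg' : g * gᵀ = 1 := mul_eq_one_comm.1 hg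
  have ho : ∀ i j, ∑ a, g i a * g j a = if i = j then 1 else 0 := by
    intro i j
    have := congrFun (congrFun hg' i) j
    simpa [Matrix.mul_apply, Matrix.one_apply] using this
  let A := {p : Fin l // p < β.pair p}
  let f : A ⊕ A → Fin l := Sum.elim (fun p => p.1) (fun p => β.pair p.1)
  have hinj : Function.Injective β.pair := Function.LeftInverse.injective β.invol
  have hf : Function.Bijective f := by
    constructor
    · rintro (x | x) (y | y) h
      · exact congrArg _ (Subtype.ext h)
      · exfalso
        have h : x.1 = β.pair y.1 := h
        have hx := x.2
        rw [h, β.invol] at hx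
        exact absurd y.2 (not_lt.2 hx.le)
      · exfalso
        have h : β.pair x.1 = y.1 := h
        have hy := y.2
        rw [← h, β.invol] at hy
        exact absurd x.2 (not_lt.2 hy.le)
      · exact congrArg _ (Subtype.ext (hinj h))
    · intro p
      rcases lt_or_gt_of_ne (β.ne p) with h1 | h1
      · exact ⟨Sum.inr ⟨β.pair p, by rw [β.invol]; exact h1⟩, β.invol p⟩
      · exact ⟨Sum.inl ⟨p, h1⟩, rfl⟩
  let e : A ⊕ A ≃ Fin l := Equiv.ofBijective f hf
  have hv : ∀ J : Fin l → Fin n, vec n β J =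
      ∏ p : A, if J p.1 = J (β.pair p.1) then (1 : ℝ) else 0 := by
    intro J
    unfold vec
    rw [Finset.prod_subtype (p := fun p => p < β.pair p)]
    simp
  let E : (A → Fin n × Fin n) ≃ (Fin l → Fin n) :=
    (Equiv.arrowProdEquivProdArrow A (fun _ => Fin n) (fun _ => Fin n)).trans
      ((Equiv.sumArrowEquivProdArrow A A (Fin n)).symm.trans
        (Equiv.arrowCongr e (Equiv.refl _)))
  have hE1 : ∀ K (p : A), E K p.1 = (K p).1 := by
    intro K p
    have : e.symm p.1 = Sum.inl p := by rw [Equiv.symm_apply_eq]; rfl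
    simp [E, Equiv.arrowCongr, this]
  have hE2 : ∀ K (p : A), E K (β.pair p.1) = (K p).2 := by
    intro K p
    have : e.symm (β.pair p.1) = Sum.inr p := by rw [Equiv.symm_apply_eq]; rfl
    simp [E, Equiv.arrowCongr, this]
  have hterm : ∀ K : A → Fin n × Fin n, (∏ r, g (I r) (E K r)) * vec n β (E K) =
      ∏ p : A, (g (I p.1) (K p).1 * g (I (β.pair p.1)) (K p).2 *
        if (K p).1 = (K p).2 then (1 : ℝ) else 0) := by
    intro K
    rw [hv, ← Equiv.prod_comp e, Fintype.prod_sum_type, ← Finset.prod_mul_distrib,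
      ← Finset.prod_mul_distrib]
    refine Finset.prod_congr rfl fun p _ => ?_
    have e1 : e (Sum.inl p) = p.1 := rfl
    have e2 : e (Sum.inr p) = β.pair p.1 := rfl
    rw [e1, e2, hE1, hE2]
  rw [← Equiv.sum_comp E]
  simp only [hterm]
  rw [← Fintype.prod_sum (fun (p : A) (k : Fin n × Fin n) =>
    (g (I p.1) k.1 * g (I (β.pair p.1)) k.2 * if k.1 = k.2 then (1 : ℝ) else 0)), hv]
  refine Finset.prod_congr rfl fun p _ => ?_
  rw [Fintype.sum_prod_type]
  simp [ho]

/-- span of the pairing vectors -/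
def S (n l : ℕ) : Submodule ℝ ((Fin l → Fin n) → ℝ) :=
  Submodule.span ℝ {v : (Fin l → Fin n) → ℝ | ∃ β : BrauerPairing l, v = vec n β}

lemma inv_of_mem {l : ℕ} {c : (Fin l → Fin n) → ℝ} (hc : c ∈ S n l) : Inv c := by
  rw [inv_iff]
  intro g hg
  refine Submodule.span_induction (p := fun c _ => (tpowM l g).mulVec c = c) ?_ ?_ ?_ ?_ hc
  · rintro _ ⟨β, rfl⟩
    exact (inv_iff _).1 (vec_inv β) g hg
  · simp
  · intro x y _ _ hx hy
    rw [Matrix.mulVec_add, hx, hy]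
  · intro a x _ hx
    rw [Matrix.mulVec_smul, hx]

lemma mem_of_inv {l : ℕ} {c : (Fin l → Fin n) → ℝ} (hc : Inv c) : c ∈ S n l := by
  let L := (WithLp.linearEquiv 2 ℝ ((Fin l → Fin n) → ℝ)).symm
  obtain ⟨s, hs, w, hw, hsw⟩ :=
    ((S n l).map L.toLinearMap).exists_add_mem_mem_orthogonal (L c)
  obtain ⟨s', hs', rfl⟩ := hs
  obtain ⟨w', rfl⟩ := L.surjective w
  have hcs : c = s' + w' := L.injective (by rw [map_add]; exact hsw)
  have hw' : Inv w' := by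
    have h1 := inv_of_mem hs'
    rw [inv_iff] at h1 hc ⊢
    intro g hg
    have : w' = c - s' := by rw [hcs]; simp
    rw [this, Matrix.mulVec_sub, hc g hg, h1 g hg]
  have : w' = 0 := by
    refine main_aux _ (Fin l) w' rfl hw' ?_
    intro β h1 h2
    have hm := (Submodule.mem_orthogonal _ _).1 hw (L (vec n ⟨β, h1, h2⟩))
      ⟨_, Submodule.subset_span ⟨_, rfl⟩, rfl⟩
    rw [PiLp.inner_apply] at hm
    refine Eq.trans ?_ hm
    refine Finset.sum_congr rfl fun I _ => ?_
    have := vec_eq (n := n) ⟨β, h1, h2⟩ I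
    change _ = w' I * vec n ⟨β, h1, h2⟩ I
    rw [this]
    simp
  rw [hcs, this, add_zero]
  exact hs'

end FFT

/-- A vector `c ∈ (ℝⁿ)^{⊗l}` (given by its coordinates in the standard basis) is
`O(n)`-invariant, i.e. `g^{⊗l} c = c` for all `g ∈ O(n)`, iff it lies in the span
of the vectors `v_β = ∑_I (∏_{{p,q} ∈ β} δ_{i_p, i_q}) e_{i₁} ⊗ … ⊗ e_{i_l}`,
where `β` ranges over partitions of `{1, …, l}` into disjoint pairs.  In
particular, if `l` is odd then `c = 0` is the only such vector. -/
theorem stmt18 (n l : ℕ) (hn : 1 ≤ n) (c : (Fin l → Fin n) → ℝ) :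
    ((∀ g : Matrix (Fin n) (Fin n) ℝ, gᵀ * g = 1 → (tpowM l g).mulVec c = c) ↔
      c ∈ Submodule.span ℝ
        {v : (Fin l → Fin n) → ℝ | ∃ β : BrauerPairing l,
          v = fun I => ∏ p ∈ Finset.univ.filter (fun p => p < β.pair p),
            if I p = I (β.pair p) then (1 : ℝ) else 0}) ∧
    (Odd l → (∀ g : Matrix (Fin n) (Fin n) ℝ, gᵀ * g = 1 →
        (tpowM l g).mulVec c = c) → c = 0) := by
  refine ⟨⟨fun h => FFT.mem_of_inv ((FFT.inv_iff c).2 h),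
    fun h => (FFT.inv_iff c).1 (FFT.inv_of_mem h)⟩, ?_⟩
  intro hl h
  funext I
  have := FFT.inv_diag ((FFT.inv_iff c).2 h) (fun _ => -1) (by simp) I
  rw [Finset.prod_const, Finset.card_univ, Fintype.card_fin, hl.neg_one_pow] at this
  simp only [Pi.zero_apply]
  linarith
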